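/- arXiv:2412.15977 — 2 statements merged into one kernel-verified Lean document; each statement's English description precedes it below -/
import Mathlib

section
/- Suppose Δy ≠ 0 and let Δȳ ∈ ℝ^m be any vector with S⁻¹AᵀΔȳ ≠ 0. If ‖Δȳ − Δy/‖Δy‖₂‖₂ ≤ (0.005/1.995)·‖S⁻¹AᵀΔy‖₂/(‖S⁻¹Aᵀ‖₂·‖Δy‖₂), where ‖S⁻¹Aᵀ‖₂ is the spectral norm, then cos ψ ≥ 0.995, where ψ is the angle between S⁻¹AᵀΔy and S⁻¹AᵀΔȳ, i.e., cos ψ = (ΔyᵀAS⁻²AᵀΔȳ)/(‖S⁻¹AᵀΔy‖₂·‖S⁻¹AᵀΔȳ‖₂). -/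
open Matrix

/-- Euclidean norm of a vector in `ℝ^k`. -/
noncomputable def norm2 {k : ℕ} (v : Fin k → ℝ) : ℝ := Real.sqrt (∑ i, v i ^ 2)

theorem norm2_eq_norm {k : ℕ} (v : Fin k → ℝ) : norm2 v = ‖WithLp.toLp 2 v‖ := by
  simp [norm2, EuclideanSpace.norm_eq]

/-- The supremum of `‖M u‖` over unit vectors `u` is an operator bound for `M`. -/
theorem norm2_mulVec_le_sSup {m n : ℕ} (M : Matrix (Fin n) (Fin m) ℝ) (v : Fin m → ℝ) :
    norm2 (M *ᵥ v) ≤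
      sSup {t : ℝ | ∃ u : Fin m → ℝ, norm2 u = 1 ∧ t = norm2 (M *ᵥ u)} * norm2 v := by
  set L := (Matrix.toEuclideanLin M).toContinuousLinearMap with hL
  have hLM (u : Fin m → ℝ) : norm2 (M *ᵥ u) = ‖L (WithLp.toLp 2 u)‖ := by
    simp [norm2_eq_norm, hL, Matrix.toLpLin_apply]
  have hbdd : BddAbove {t : ℝ | ∃ u : Fin m → ℝ, norm2 u = 1 ∧ t = norm2 (M *ᵥ u)} := by
    refine ⟨‖L‖, ?_⟩
    rintro t ⟨u, hu, rfl⟩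
    rw [norm2_eq_norm] at hu
    simpa [hLM, hu] using L.le_opNorm (WithLp.toLp 2 u)
  rcases eq_or_ne v 0 with rfl | hv
  · simp [norm2]
  have hpos : 0 < norm2 v := by
    rw [norm2_eq_norm, norm_pos_iff]
    simpa using hv
  rw [← div_le_iff₀ hpos]
  refine le_csSup hbdd ⟨(norm2 v)⁻¹ • v, ?_, ?_⟩
  · rw [norm2_eq_norm, WithLp.toLp_smul, norm_smul, ← norm2_eq_norm, norm_inv,
      Real.norm_of_nonneg hpos.le, inv_mul_cancel₀ hpos.ne']
  · rw [Matrix.mulVec_smul, norm2_eq_norm ((norm2 v)⁻¹ • _), WithLp.toLp_smul, norm_smul,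
      ← norm2_eq_norm, norm_inv, Real.norm_of_nonneg hpos.le, div_eq_inv_mul]

/-- A relative perturbation of size `c` turns a vector by an angle whose cosine is at least
`(1 - c) / (1 + c)`. -/
theorem mul_norm_mul_norm_le_inner_of_norm_sub_le {E : Type*} [NormedAddCommGroup E]
    [InnerProductSpace ℝ E] {x y : E} {c : ℝ} (hc0 : 0 ≤ c) (hc1 : c ≤ 1)
    (h : ‖y - x‖ ≤ c * ‖x‖) :
    (1 - c) / (1 + c) * (‖x‖ * ‖y‖) ≤ inner ℝ x y := by
  have hy : ‖y‖ ≤ (1 + c) * ‖x‖ := by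
    linarith [norm_le_insert' y x]
  have hd : -(‖x‖ * ‖y - x‖) ≤ inner ℝ x (y - x) :=
    neg_le_of_abs_le (abs_real_inner_le_norm x (y - x))
  rw [inner_sub_right, real_inner_self_eq_norm_sq] at hd
  calc (1 - c) / (1 + c) * (‖x‖ * ‖y‖)
      ≤ (1 - c) / (1 + c) * (‖x‖ * ((1 + c) * ‖x‖)) := by
        have : 0 ≤ (1 - c) / (1 + c) := div_nonneg (by linarith) (by linarith)
        gcongr
    _ = (1 - c) * ‖x‖ ^ 2 := by
        have : 1 + c ≠ 0 := by positivity
        field_simp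
    _ ≤ inner ℝ x y := by nlinarith [mul_le_mul_of_nonneg_left h (norm_nonneg x)]

theorem inv_mul_transpose_mulVec {m n : ℕ} (A : Matrix (Fin m) (Fin n) ℝ) (s : Fin n → ℝ)
    (u : Fin m → ℝ) : s⁻¹ * Aᵀ *ᵥ u = (diagonal s⁻¹ * Aᵀ) *ᵥ u := by
  ext i
  rw [← mulVec_mulVec, mulVec_diagonal, Pi.mul_apply]

theorem dotProduct_scaledGram_mulVec {m n : ℕ} (A : Matrix (Fin m) (Fin n) ℝ) (s : Fin n → ℝ)
    (u v : Fin m → ℝ) :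
    u ⬝ᵥ (A * diagonal (fun i => ((s i) ^ 2)⁻¹) * Aᵀ) *ᵥ v =
      ((diagonal s⁻¹ * Aᵀ) *ᵥ u) ⬝ᵥ ((diagonal s⁻¹ * Aᵀ) *ᵥ v) := by
  have hdiag : diagonal (fun i => ((s i) ^ 2)⁻¹) = diagonal s⁻¹ * diagonal s⁻¹ := by
    rw [diagonal_mul_diagonal]
    congr 1
    ext i
    simp [sq]
  have hgram : A * diagonal (fun i => ((s i) ^ 2)⁻¹) * Aᵀ =
      (diagonal s⁻¹ * Aᵀ)ᵀ * (diagonal s⁻¹ * Aᵀ) := by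
    rw [hdiag, transpose_mul, transpose_transpose, diagonal_transpose]
    simp only [Matrix.mul_assoc]
  rw [hgram, ← mulVec_mulVec, dotProduct_mulVec, vecMul_transpose]

/-- If `Δy ≠ 0`, `S⁻¹AᵀΔȳ ≠ 0` and
`‖Δȳ − Δy/‖Δy‖‖ ≤ (0.005/1.995)·‖S⁻¹AᵀΔy‖/(‖S⁻¹Aᵀ‖·‖Δy‖)` (spectral norm in the
denominator), then `cos ψ ≥ 0.995`, where `ψ` is the angle between `S⁻¹AᵀΔy` and
`S⁻¹AᵀΔȳ`. -/
theorem stmt7 {m n : ℕ} (A : Matrix (Fin m) (Fin n) ℝ) (b : Fin m → ℝ)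
    (hrank : A.rank = m) (hmn : m ≤ n)
    (s : Fin n → ℝ) (hs : ∀ i, 0 < s i)
    (μ : ℝ) (hμ : 0 < μ)
    (rp : Fin m → ℝ) (hrp : rp = b - μ • A.mulVec s⁻¹)
    (Δy : Fin m → ℝ)
    (hΔy : Δy = (1 / μ) •
      ((A * Matrix.diagonal (fun i => ((s i) ^ 2)⁻¹) * A.transpose)⁻¹).mulVec rp)
    (hΔy0 : Δy ≠ 0)
    (Δybar : Fin m → ℝ)
    (hw₂0 : s⁻¹ * A.transpose.mulVec Δybar ≠ 0)
    (snorm : ℝ)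
    (hsnorm : snorm = sSup {t : ℝ | ∃ u : Fin m → ℝ, norm2 u = 1 ∧
      t = norm2 (s⁻¹ * A.transpose.mulVec u)})
    (hclose : norm2 (Δybar - (1 / norm2 Δy) • Δy) ≤
      (0.005 / 1.995) * norm2 (s⁻¹ * A.transpose.mulVec Δy) / (snorm * norm2 Δy))
    (cosψ : ℝ)
    (hcos : cosψ = (Δy ⬝ᵥ (A * Matrix.diagonal (fun i => ((s i) ^ 2)⁻¹) *
        A.transpose).mulVec Δybar) /
      (norm2 (s⁻¹ * A.transpose.mulVec Δy) * norm2 (s⁻¹ * A.transpose.mulVec Δybar))) :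
    0.995 ≤ cosψ := by
  simp only [inv_mul_transpose_mulVec, dotProduct_scaledGram_mulVec] at *
  set M := diagonal s⁻¹ * Aᵀ
  have hN : 0 < norm2 Δy := by
    rw [norm2_eq_norm, norm_pos_iff]
    simpa using hΔy0
  have hq : 0 < norm2 (M *ᵥ Δybar) := by
    rw [norm2_eq_norm, norm_pos_iff]
    simpa using hw₂0
  have hK : 0 ≤ snorm := by
    rw [hsnorm]
    apply Real.sSup_nonneg
    rintro t ⟨u, -, rfl⟩
    exact Real.sqrt_nonneg _
  have hp0 : 0 ≤ norm2 (M *ᵥ Δy) := Real.sqrt_nonneg _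
  have hpert : norm2 (M *ᵥ Δybar - (1 / norm2 Δy) • M *ᵥ Δy) ≤
      1 / 399 * ((1 / norm2 Δy) * norm2 (M *ᵥ Δy)) := by
    rw [← mulVec_smul, ← mulVec_sub]
    refine (norm2_mulVec_le_sSup M _).trans ?_
    rw [← hsnorm]
    refine (mul_le_mul_of_nonneg_left hclose hK).trans ?_
    rcases hK.eq_or_lt with h | h
    · rw [← h, zero_mul]
      positivity
    · apply le_of_eq
      field_simp
      ring
  have hnorm : ‖(1 / norm2 Δy) • WithLp.toLp 2 (M *ᵥ Δy)‖ =
      (1 / norm2 Δy) * norm2 (M *ᵥ Δy) := by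
    rw [norm_smul, Real.norm_of_nonneg (by positivity), ← norm2_eq_norm]
  have hpert' : ‖WithLp.toLp 2 (M *ᵥ Δybar) - (1 / norm2 Δy) • WithLp.toLp 2 (M *ᵥ Δy)‖ ≤
      1 / 399 * ‖(1 / norm2 Δy) • WithLp.toLp 2 (M *ᵥ Δy)‖ := by
    rw [hnorm, ← WithLp.toLp_smul, ← WithLp.toLp_sub, ← norm2_eq_norm]
    exact hpert
  have hp : 0 < norm2 (M *ᵥ Δy) := by
    refine hp0.lt_of_ne' fun h => hq.ne' ?_
    have hzero : WithLp.toLp 2 (M *ᵥ Δy) = 0 := by rwa [norm2_eq_norm, norm_eq_zero] at h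
    rw [hzero, smul_zero, sub_zero, norm_zero, mul_zero, ← norm2_eq_norm] at hpert'
    exact hpert'.antisymm hq.le
  have hinner := mul_norm_mul_norm_le_inner_of_norm_sub_le (by norm_num) (by norm_num) hpert'
  rw [hnorm, ← norm2_eq_norm, real_inner_smul_left, EuclideanSpace.inner_toLp_toLp, star_trivial,
    dotProduct_comm, mul_assoc, mul_left_comm] at hinner
  have hcosine := le_of_mul_le_mul_left hinner (by positivity)
  rw [hcos, le_div_iff₀ (by positivity)]
  norm_num at hcosine ⊢
  exact hcosine
end

section
/- Suppose δ(s,μ) ≤ 0.5 and the inexactness vector E satisfies ‖s⁻¹∘E‖₂ ≤ 0.1·δ(s,μ). Define h = (s⁻¹∘Δs)∘(s⁻¹∘Δs) + (s⁻¹∘Δs − e)∘(s⁻¹∘E). Then ‖h‖₂² ≤ δ(s,μ)⁴ + 0.06. -/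
open Matrix

theorem norm2_nonneg {k : ℕ} (v : Fin k → ℝ) : 0 ≤ norm2 v := Real.sqrt_nonneg _

theorem norm2_sq {k : ℕ} (v : Fin k → ℝ) : norm2 v ^ 2 = ∑ i, v i ^ 2 :=
  Real.sq_sqrt (Finset.sum_nonneg fun _ _ => sq_nonneg _)

theorem sq_apply_le_norm2_sq {k : ℕ} (v : Fin k → ℝ) (i : Fin k) : v i ^ 2 ≤ norm2 v ^ 2 := by
  rw [norm2_sq]
  exact Finset.single_le_sum (f := fun j => v j ^ 2) (fun _ _ => sq_nonneg _) (Finset.mem_univ i)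

/-- A weighted Young inequality for the vector `u ∘ u + (u - e) ∘ w` when `‖u‖ ≤ 1/2`. -/
theorem norm2_mul_self_add_sub_one_mul_sq_le {k : ℕ} (u w : Fin k → ℝ)
    (hu : norm2 u ≤ 1 / 2) :
    norm2 (u * u + (u - 1) * w) ^ 2 ≤ 3 / 2 * norm2 u ^ 4 + 27 / 4 * norm2 w ^ 2 := by
  have key : ∀ i, (u * u + (u - 1) * w) i ^ 2 ≤
      3 / 2 * norm2 u ^ 2 * u i ^ 2 + 27 / 4 * w i ^ 2 := by
    intro i
    have hui := sq_apply_le_norm2_sq u i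
    have habs : |u i| ≤ 1 / 2 := (abs_le_of_sq_le_sq hui (norm2_nonneg u)).trans hu
    obtain ⟨hlo, hhi⟩ := abs_le.mp habs
    have hcoef : (u i - 1) ^ 2 ≤ 9 / 4 := by nlinarith
    have hw := mul_le_mul_of_nonneg_right hcoef (sq_nonneg (w i))
    have hquart := mul_le_mul_of_nonneg_right hui (sq_nonneg (u i))
    simp only [Pi.add_apply, Pi.mul_apply, Pi.sub_apply, Pi.one_apply]
    nlinarith [sq_nonneg (u i * u i - 2 * ((u i - 1) * w i))]
  calc norm2 (u * u + (u - 1) * w) ^ 2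
      = ∑ i, (u * u + (u - 1) * w) i ^ 2 := norm2_sq _
    _ ≤ ∑ i, (3 / 2 * norm2 u ^ 2 * u i ^ 2 + 27 / 4 * w i ^ 2) :=
        Finset.sum_le_sum fun i _ => key i
    _ = 3 / 2 * norm2 u ^ 4 + 27 / 4 * norm2 w ^ 2 := by
        rw [Finset.sum_add_distrib, ← Finset.mul_sum, ← Finset.mul_sum, ← norm2_sq, ← norm2_sq]
        ring

/-- If `δ(s,μ) ≤ 0.5` and `‖s⁻¹∘E‖ ≤ 0.1·δ(s,μ)`, then
`h = (s⁻¹∘Δs)∘(s⁻¹∘Δs) + (s⁻¹∘Δs − e)∘(s⁻¹∘E)` satisfies `‖h‖² ≤ δ⁴ + 0.06`. -/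
theorem stmt14 {m n : ℕ} (A : Matrix (Fin m) (Fin n) ℝ) (b : Fin m → ℝ)
    (hrank : A.rank = m) (hmn : m ≤ n)
    (s : Fin n → ℝ) (hs : ∀ i, 0 < s i)
    (μ : ℝ) (hμ : 0 < μ)
    (rp : Fin m → ℝ) (hrp : rp = b - μ • A.mulVec s⁻¹)
    (Δy : Fin m → ℝ)
    (hΔy : Δy = (1 / μ) •
      ((A * Matrix.diagonal (fun i => ((s i) ^ 2)⁻¹) * A.transpose)⁻¹).mulVec rp)
    (Δs : Fin n → ℝ) (hΔs : Δs = -(A.transpose.mulVec Δy))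
    (δ : ℝ) (hδ : δ = norm2 (s⁻¹ * Δs)) (hδle : δ ≤ 0.5)
    (E : Fin n → ℝ) (hEsmall : norm2 (s⁻¹ * E) ≤ 0.1 * δ)
    (h : Fin n → ℝ)
    (hh : h = (s⁻¹ * Δs) * (s⁻¹ * Δs) + (s⁻¹ * Δs - 1) * (s⁻¹ * E)) :
    norm2 h ^ 2 ≤ δ ^ 4 + 0.06 := by
  have hbound := norm2_mul_self_add_sub_one_mul_sq_le (s⁻¹ * Δs) (s⁻¹ * E)
    (by rw [← hδ]; linarith)
  rw [← hh, ← hδ] at hbound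
  have hδ0 : 0 ≤ δ := hδ ▸ norm2_nonneg _
  have hE : norm2 (s⁻¹ * E) ^ 2 ≤ (0.1 * δ) ^ 2 :=
    pow_le_pow_left₀ (norm2_nonneg _) hEsmall 2
  have hδ2 : δ ^ 2 ≤ 1 / 4 := by nlinarith
  have hδ4 : δ ^ 4 ≤ 1 / 16 := by nlinarith [sq_nonneg δ]
  nlinarith
end
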